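/- Improved-regularity forward estimate, single-mode version (Theorem 3.6 of the paper): there exists a constant C > 0, depending only on q' and F, such that for every λ ≥ 0 and every pair (a, c) solving the mode-λ model system on (0,∞) with asymptotic data (c₀, O, h) at τ = 0, setting 𝔥 := h − O·log√(1+λ²) (the single-mode version of the renormalization 𝔥 = h − (log∇)O), one has: (i) √(1+λ²)·a(1)² + (1+λ²)^(−1/2)·a'(1)² ≤ C·( 𝔥² + O² + (1+λ²)^(−1/2)·c₀² ); (ii) √(1+λ²)·c(1)² ≤ C·( 𝔥² + O² + √(1+λ²)·c₀² ). -/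

import Mathlib

open Set Filter

/-- The pair `(a, c)` solves the mode-`lam` model system on `I ⊆ (0,∞)`:
`a` is twice differentiable and `c` is differentiable on `I`, and for all `τ ∈ I`,
(E) `a'' + τ⁻¹·a' + 4q'·a + 4λ²·(τ²+1)⁻²·a = f₁·τ·a' + f₂·τ²·a + f₃·c` and
(C) `c' = 2τ·a`. -/
def SolvesModelSystem (q' : ℝ) (f₁ f₂ f₃ : ℝ → ℝ) (lam : ℝ)
    (a c : ℝ → ℝ) (I : Set ℝ) : Prop :=
  ∀ τ ∈ I,
    DifferentiableAt ℝ a τ ∧ DifferentiableAt ℝ (deriv a) τ ∧ DifferentiableAt ℝ c τ ∧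
    (deriv (deriv a) τ + τ⁻¹ * deriv a τ + 4 * q' * a τ
        + 4 * lam ^ 2 * ((τ ^ 2 + 1) ^ 2)⁻¹ * a τ
      = f₁ τ * τ * deriv a τ + f₂ τ * τ ^ 2 * a τ + f₃ τ * c τ) ∧
    deriv c τ = 2 * τ * a τ

/-- The pair `(a, c)` (solving the model system on `(0,∞)`, with `c` extended
continuously to `[0,∞)`) has asymptotic data `(c₀, O, h)` at `τ = 0`. -/
def HasAsymptoticData (a c : ℝ → ℝ) (c₀ O h : ℝ) : Prop :=
  ContinuousOn c (Ici 0) ∧ c 0 = c₀ ∧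
  ∃ K : ℝ, 0 ≤ K ∧ ∀ τ ∈ Ioc (0:ℝ) 1,
    |a τ - O * Real.log τ - h| ≤ K * τ ^ 2 * (1 + Real.log τ ^ 2) ∧
    |deriv a τ - O / τ| ≤ K * τ * (1 + Real.log τ ^ 2)

/-- The potential of the mode equation. -/
noncomputable def modePotential (q' lam τ : ℝ) : ℝ :=
  4 * q' + 4 * lam ^ 2 * ((τ ^ 2 + 1) ^ 2)⁻¹

lemma sq_le_modePotential {q' lam M t : ℝ} (hq : 1 ≤ q') (hM : M ^ 2 = 1 + lam ^ 2)
    (ht0 : 0 ≤ t) (ht : t ≤ 1) : M ^ 2 ≤ modePotential q' lam t := by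
  have h1 : (4 : ℝ)⁻¹ ≤ ((t ^ 2 + 1) ^ 2)⁻¹ := by
    apply inv_anti₀ (by positivity)
    have : t ^ 2 ≤ 1 := by nlinarith
    nlinarith
  unfold modePotential
  nlinarith [mul_le_mul_of_nonneg_left h1 (sq_nonneg lam)]

lemma modePotential_le {q' lam M : ℝ} (t : ℝ) (hq : 1 ≤ q') (hM : M ^ 2 = 1 + lam ^ 2) :
    modePotential q' lam t ≤ 4 * q' * M ^ 2 := by
  have h1 : ((t ^ 2 + 1) ^ 2)⁻¹ ≤ (1 : ℝ) := by
    apply inv_le_one_of_one_le₀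
    nlinarith [sq_nonneg t, sq_nonneg (t ^ 2)]
  unfold modePotential
  nlinarith [mul_le_mul_of_nonneg_left h1 (sq_nonneg lam), sq_nonneg lam]

lemma hasDerivAt_modePotential (q' lam t : ℝ) :
    HasDerivAt (modePotential q' lam) (-(16 * lam ^ 2 * t * ((t ^ 2 + 1) ^ 3)⁻¹)) t := by
  have h0 : t ^ 2 + 1 ≠ 0 := by positivity
  have h1 : HasDerivAt (fun τ : ℝ => (τ ^ 2 + 1) ^ 2) (2 * (t ^ 2 + 1) * (2 * t)) t := by
    have := (((hasDerivAt_id t).pow 2).add_const 1).pow 2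
    refine this.congr_deriv ?_
    simp
  have h2 := ((h1.inv (pow_ne_zero 2 h0)).const_mul (4 * lam ^ 2)).const_add (4 * q')
  refine h2.congr_deriv ?_
  field_simp
  ring

/-- A Grönwall inequality in integrated form. -/
lemma gronwall_exp_le {u g r u' g' r' : ℝ → ℝ} {x y : ℝ} (hxy : x ≤ y)
    (hu : ∀ t ∈ Icc x y, HasDerivAt u (u' t) t) (hg : ∀ t ∈ Icc x y, HasDerivAt g (g' t) t)
    (hr : ∀ t ∈ Icc x y, HasDerivAt r (r' t) t) (hg0 : ∀ t ∈ Icc x y, 0 ≤ g t)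
    (hr0 : ∀ t ∈ Icc x y, 0 ≤ r' t) (h : ∀ t ∈ Icc x y, u' t ≤ g' t * u t + r' t) :
    Real.exp (-g y) * u y - r y ≤ Real.exp (-g x) * u x - r x := by
  have hd : ∀ t ∈ Icc x y, HasDerivAt (fun t => Real.exp (-g t) * u t - r t)
      (Real.exp (-g t) * (-g' t) * u t + Real.exp (-g t) * u' t - r' t) t := fun t ht =>
    (((hg t ht).neg.exp).mul (hu t ht)).sub (hr t ht)
  have hanti : AntitoneOn (fun t => Real.exp (-g t) * u t - r t) (Icc x y) := by
    apply antitoneOn_of_deriv_nonpos (convex_Icc x y)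
    · exact fun t ht => (hd t ht).continuousAt.continuousWithinAt
    · exact fun t ht => (hd t (interior_subset ht)).differentiableAt.differentiableWithinAt
    · intro t ht
      have ht := interior_subset ht
      rw [(hd t ht).deriv]
      have he : Real.exp (-g t) ≤ 1 := Real.exp_le_one_iff.2 (by linarith [hg0 t ht])
      have h1 := mul_le_mul_of_nonneg_left (h t ht) (Real.exp_pos (-g t)).le
      have h2 := mul_le_mul_of_nonneg_right he (hr0 t ht)
      nlinarith
  exact hanti (left_mem_Icc.2 hxy) (right_mem_Icc.2 hxy) hxy

lemma mul_le_of_sq_le {x y X Y : ℝ} (hx : x ^ 2 ≤ X) (hy : y ^ 2 ≤ Y) :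
    |x| * |y| ≤ (X + Y) / 2 := by
  nlinarith [sq_nonneg (|x| - |y|), sq_abs x, sq_abs y]

/-- The source-term inequality for the rescaled energy near `τ = 0`. -/
lemma inner_energy_bound {q' F s p A e O L H γ a v G : ℝ} (hq : 0 ≤ q') (hF : 0 ≤ F)
    (hs : 0 < s) (hs1 : s ≤ 1) (ha : a = A + O * L + H) (hv0 : 0 ≤ v) (hv : v ≤ 4 * q')
    (hG : |G| ≤ F * (|p| + |O| + |a| + |γ| + |e|)) :
    2 * p * (-p / s - v * a + G) + 2 * A * p + 4 * e * s * a ≤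
      (16 * q' + 12 * F + 10) *
        (p ^ 2 + A ^ 2 + e ^ 2 + (O ^ 2 + H ^ 2 + γ ^ 2) * (1 + L ^ 2)) := by
  set X := p ^ 2 + A ^ 2 + e ^ 2 + (O ^ 2 + H ^ 2 + γ ^ 2) * (1 + L ^ 2) with hX
  have n1 : 0 ≤ O ^ 2 * L ^ 2 := by positivity
  have n2 : 0 ≤ H ^ 2 * L ^ 2 := by positivity
  have n3 : 0 ≤ γ ^ 2 * L ^ 2 := by positivity
  have hp : p ^ 2 ≤ X := by nlinarith
  have hA : A ^ 2 ≤ X := by nlinarith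
  have he : e ^ 2 ≤ X := by nlinarith
  have hO : O ^ 2 ≤ X := by nlinarith
  have hγ : γ ^ 2 ≤ X := by nlinarith
  have hX0 : 0 ≤ X := (sq_nonneg p).trans hp
  have ha2 : a ^ 2 ≤ 3 * X := by
    rw [ha]
    nlinarith [sq_nonneg (A - O * L), sq_nonneg (A - H), sq_nonneg (O * L - H), sq_nonneg O,
      sq_nonneg H, sq_nonneg γ, sq_nonneg p, sq_nonneg e]
  have b1 := mul_le_of_sq_le hp ha2
  have b2 := mul_le_of_sq_le hp hp
  have b3 := mul_le_of_sq_le hp hO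
  have b4 := mul_le_of_sq_le hp hγ
  have b5 := mul_le_of_sq_le hp he
  have b6 := mul_le_of_sq_le hA hp
  have b7 := mul_le_of_sq_le he ha2
  have t1 : 2 * p * (-p / s) ≤ 0 := by
    have : 2 * p * (-p / s) = -(2 * (p ^ 2 / s)) := by ring
    rw [this]
    have : 0 ≤ p ^ 2 / s := by positivity
    linarith
  have t2 : -(p * (v * a)) ≤ 4 * q' * (2 * X) := by
    calc -(p * (v * a)) ≤ |p * (v * a)| := neg_le_abs _
      _ = v * (|p| * |a|) := by rw [abs_mul, abs_mul, abs_of_nonneg hv0]; ring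
      _ ≤ 4 * q' * (2 * X) := by
        apply mul_le_mul hv (by linarith) (by positivity) (by linarith)
  have t3 : p * G ≤ F * (6 * X) := by
    calc p * G ≤ |p * G| := le_abs_self _
      _ = |p| * |G| := abs_mul _ _
      _ ≤ |p| * (F * (|p| + |O| + |a| + |γ| + |e|)) := by gcongr
      _ = F * (|p| * |p| + |p| * |O| + |p| * |a| + |p| * |γ| + |p| * |e|) := by ring
      _ ≤ F * (6 * X) := by
        apply mul_le_mul_of_nonneg_left _ hF
        linarith
  have t4 : A * p ≤ X := by
    have := le_abs_self (A * p)
    rw [abs_mul] at this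
    linarith
  have t5 : e * s * a ≤ 2 * X := by
    calc e * s * a ≤ |e * s * a| := le_abs_self _
      _ = s * (|e| * |a|) := by rw [abs_mul, abs_mul, abs_of_pos hs]; ring
      _ ≤ 1 * (|e| * |a|) := by gcongr
      _ ≤ 2 * X := by linarith
  calc 2 * p * (-p / s - v * a + G) + 2 * A * p + 4 * e * s * a
      = 2 * p * (-p / s) + 2 * -(p * (v * a)) + 2 * (p * G) + 2 * (A * p)
        + 4 * (e * s * a) := by ring
    _ ≤ 0 + 2 * (4 * q' * (2 * X)) + 2 * (F * (6 * X)) + 2 * X + 4 * (2 * X) := by gcongr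
    _ = _ := by ring

lemma abs_mul_le_energy {M t w x y : ℝ} (hM : 1 ≤ M) (ht : 0 < t) (hw : M ^ 2 ≤ w) :
    |x * y| ≤ t * (y ^ 2 + w * x ^ 2) / (2 * (M * t)) := by
  have hM0 : 0 < M := by linarith
  rw [le_div_iff₀ (by positivity), abs_mul]
  have h1 : 2 * (M * |x|) * |y| ≤ M ^ 2 * x ^ 2 + y ^ 2 := by
    nlinarith [sq_nonneg (M * |x| - |y|), sq_abs x, sq_abs y]
  have h2 := mul_le_mul_of_nonneg_right hw (sq_nonneg x)
  calc |x| * |y| * (2 * (M * t)) = t * (2 * (M * |x|) * |y|) := by ring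
    _ ≤ t * (y ^ 2 + w * x ^ 2) := by
      apply mul_le_mul_of_nonneg_left _ ht.le
      linarith

/-- The source-term inequality for the corrected energy on the oscillatory region. -/
lemma outer_energy_bound {F M t w w' μ x y c G : ℝ} (hF : 0 ≤ F) (hM : 1 ≤ M) (ht : 0 < t)
    (hMt : 1 ≤ M * t) (ht1 : t ≤ 1) (hw : M ^ 2 ≤ w) (hw' : w' ≤ 0) (hμ : 1 ≤ μ)
    (hμM : μ ≤ M ^ 2) (hG : |G| ≤ F * (t * |y| + t ^ 2 * |x| + |c|)) :
    w' * t * x ^ 2 + 2 * t * y * G - x * y / t + x * G + 4 * μ * t * x * c ≤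
      (20 * (F + 1) + 1 / (M * t ^ 2)) * (t * (y ^ 2 + w * x ^ 2) + x * y + μ * c ^ 2) := by
  have hM0 : 0 < M := by linarith
  obtain ⟨E, hE⟩ : ∃ E, E = t * (y ^ 2 + w * x ^ 2) := ⟨_, rfl⟩
  rw [← hE]
  have hw0 : 0 ≤ w := (sq_nonneg M).trans hw
  have hE0 : 0 ≤ E := by rw [hE]; positivity
  have hxy := abs_mul_le_energy (x := x) (y := y) hM ht hw
  rw [← hE] at hxy
  have hxyE : |x * y| ≤ E / 2 := by
    refine hxy.trans ?_
    apply div_le_div_of_nonneg_left hE0 (by norm_num)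
    linarith
  have hc : c ^ 2 ≤ μ * c ^ 2 := le_mul_of_one_le_left (sq_nonneg c) hμ
  have hy2 : t * y ^ 2 ≤ E := by
    have : 0 ≤ t * (w * x ^ 2) := by positivity
    rw [hE]; linarith
  have hx2 : t * (M ^ 2 * x ^ 2) ≤ E := by
    have h1 : t * (M ^ 2 * x ^ 2) ≤ t * (w * x ^ 2) := by gcongr
    have : 0 ≤ t * y ^ 2 := by positivity
    rw [hE]; linarith
  have hx1 : x ^ 2 ≤ E := by
    refine le_trans ?_ hx2
    have : 1 ≤ t * M ^ 2 := by nlinarith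
    nlinarith [sq_nonneg x]
  obtain ⟨B, hB⟩ : ∃ B, B = E + μ * c ^ 2 := ⟨_, rfl⟩
  have hB0 : 0 ≤ B := by nlinarith [sq_nonneg c]
  have hT : B / 2 ≤ E + x * y + μ * c ^ 2 := by
    have := neg_le_abs (x * y)
    have : 0 ≤ μ * c ^ 2 := (sq_nonneg c).trans hc
    linarith
  have ax := abs_nonneg x
  have ay := abs_nonneg y
  have ac := abs_nonneg c
  have hxyB : |x| * |y| ≤ E / 2 := by rwa [← abs_mul]
  have s1 : w' * t * x ^ 2 ≤ 0 := by
    have : 0 ≤ t * x ^ 2 := by positivity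
    nlinarith
  have s2 : t * y * G ≤ F * (3 * B) := by
    have h3 : t ^ 2 * |y| ^ 2 ≤ E := by
      rw [sq_abs]
      have : t ^ 2 * y ^ 2 ≤ t * y ^ 2 := by
        apply mul_le_mul_of_nonneg_right _ (sq_nonneg y); nlinarith
      linarith
    have h4 : t ^ 3 * (|x| * |y|) ≤ E := by
      have : t ^ 3 ≤ 1 := pow_le_one₀ ht.le ht1
      have : t ^ 3 * (|x| * |y|) ≤ 1 * (|x| * |y|) := by gcongr
      linarith
    have h5 : t * |y| * |c| ≤ B := by
      have h6 := two_mul_le_add_sq (t * |y|) |c|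
      rw [mul_pow, sq_abs c] at h6
      linarith
    calc t * y * G ≤ |t * y * G| := le_abs_self _
      _ = t * |y| * |G| := by rw [abs_mul, abs_mul, abs_of_pos ht]
      _ ≤ t * |y| * (F * (t * |y| + t ^ 2 * |x| + |c|)) := by gcongr
      _ = F * (t ^ 2 * |y| ^ 2 + t ^ 3 * (|x| * |y|) + t * |y| * |c|) := by ring
      _ ≤ F * (3 * B) := by
        apply mul_le_mul_of_nonneg_left _ hF
        linarith [(sq_nonneg c).trans hc]
  have s3 : -(x * y / t) ≤ 1 / (M * t ^ 2) * (B / 2) := by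
    have hn : -(x * y) ≤ E / (2 * (M * t)) := (neg_le_abs _).trans hxy
    calc -(x * y / t) = -(x * y) / t := by ring
      _ ≤ E / (2 * (M * t)) / t := by gcongr
      _ = 1 / (M * t ^ 2) * (E / 2) := by field_simp
      _ ≤ 1 / (M * t ^ 2) * (B / 2) := by
        gcongr
        linarith [(sq_nonneg c).trans hc]
  have s4 : x * G ≤ F * (3 * B) := by
    have h3 : t * (|x| * |y|) ≤ E := by
      have : t * (|x| * |y|) ≤ 1 * (|x| * |y|) := by gcongr
      linarith
    have h4 : t ^ 2 * |x| ^ 2 ≤ E := by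
      rw [sq_abs]
      have : t ^ 2 * x ^ 2 ≤ 1 * x ^ 2 := by
        apply mul_le_mul_of_nonneg_right _ (sq_nonneg x); nlinarith
      linarith
    have h5 : |x| * |c| ≤ B := by
      have h6 := two_mul_le_add_sq |x| |c|
      rw [sq_abs, sq_abs] at h6
      linarith
    calc x * G ≤ |x * G| := le_abs_self _
      _ = |x| * |G| := abs_mul _ _
      _ ≤ |x| * (F * (t * |y| + t ^ 2 * |x| + |c|)) := by gcongr
      _ = F * (t * (|x| * |y|) + t ^ 2 * |x| ^ 2 + |x| * |c|) := by ring
      _ ≤ F * (3 * B) := by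
        apply mul_le_mul_of_nonneg_left _ hF
        linarith [(sq_nonneg c).trans hc]
  have s5 : 4 * μ * t * x * c ≤ 2 * B := by
    have h6 : μ * (t ^ 2 * x ^ 2) ≤ E := by
      calc μ * (t ^ 2 * x ^ 2) ≤ M ^ 2 * (t * x ^ 2) := by
            have : t ^ 2 ≤ t := by nlinarith
            gcongr
        _ = t * (M ^ 2 * x ^ 2) := by ring
        _ ≤ E := hx2
    have h7 := mul_nonneg (by linarith : 0 ≤ μ) (sq_nonneg (t * x - c))
    have h8 : μ * (t * x - c) ^ 2
        = μ * (t ^ 2 * x ^ 2) + μ * c ^ 2 - (4 * μ * t * x * c) / 2 := by ring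
    linarith
  have hk : 0 ≤ 20 * (F + 1) + 1 / (M * t ^ 2) := by positivity
  have hfin := mul_le_mul_of_nonneg_left hT hk
  refine le_trans ?_ hfin
  have hFB : 0 ≤ F * B := by positivity
  have e1 : 2 * t * y * G = 2 * (t * y * G) := by ring
  have e2 : (20 * (F + 1) + 1 / (M * t ^ 2)) * (B / 2)
      = 10 * (F * B) + 10 * B + 1 / (M * t ^ 2) * (B / 2) := by ring
  rw [e1, e2]
  linarith

lemma tendsto_mul_one_add_log_sq (K : ℝ) :
    Tendsto (fun x : ℝ => K * x * (1 + Real.log x ^ 2)) (nhdsWithin 0 (Ioi 0)) (nhds 0) := by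
  have h1 := (tendsto_log_mul_rpow_nhdsGT_zero (r := 1 / 2) (by norm_num)).pow 2
  have h2 : Tendsto (fun x : ℝ => x) (nhdsWithin 0 (Ioi 0)) (nhds 0) :=
    tendsto_id.mono_left nhdsWithin_le_nhds
  have h3 := (h2.add h1).const_mul K
  have h4 : K * (0 + (0 : ℝ) ^ 2) = 0 := by simp
  rw [h4] at h3
  refine h3.congr' ?_
  filter_upwards [self_mem_nhdsWithin] with x hx
  have hx : 0 < x := hx
  rw [mul_pow, ← Real.sqrt_eq_rpow, Real.sq_sqrt hx.le]
  ring

/-- The rescaled energy of the remainder `a - O log τ - h`. -/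
noncomputable def innerEnergy (M : ℝ) (a c : ℝ → ℝ) (c₀ O h t : ℝ) : ℝ :=
  ((deriv a t - O / t) / M) ^ 2 + (a t - O * Real.log t - h) ^ 2 + (M ^ 2 * (c t - c₀)) ^ 2

lemma innerEnergy_nonneg (M : ℝ) (a c : ℝ → ℝ) (c₀ O h t : ℝ) :
    0 ≤ innerEnergy M a c c₀ O h t := by
  unfold innerEnergy
  positivity

lemma tendsto_innerEnergy {a c : ℝ → ℝ} {c₀ O h : ℝ} (M : ℝ)
    (H : HasAsymptoticData a c c₀ O h) :
    Tendsto (innerEnergy M a c c₀ O h) (nhdsWithin 0 (Ioi 0)) (nhds 0) := by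
  obtain ⟨hc, hc0, K, hK, hb⟩ := H
  have hmem : Ioc (0 : ℝ) 1 ∈ nhdsWithin (0 : ℝ) (Ioi 0) := Ioc_mem_nhdsGT one_pos
  have hlim := tendsto_mul_one_add_log_sq K
  have hP : Tendsto (fun t => deriv a t - O / t) (nhdsWithin 0 (Ioi 0)) (nhds 0) := by
    apply squeeze_zero_norm' _ hlim
    filter_upwards [hmem] with t ht
    exact (hb t ht).2
  have hA : Tendsto (fun t => a t - O * Real.log t - h) (nhdsWithin 0 (Ioi 0)) (nhds 0) := by
    apply squeeze_zero_norm' _ hlim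
    filter_upwards [hmem] with t ht
    refine (hb t ht).1.trans ?_
    have : t ^ 2 ≤ t := by nlinarith [ht.1, ht.2]
    gcongr
  have hcc : Tendsto (fun t => c t - c₀) (nhdsWithin 0 (Ioi 0)) (nhds 0) := by
    have h1 : Tendsto c (nhdsWithin 0 (Ioi 0)) (nhds (c 0)) :=
      (hc 0 self_mem_Ici).mono_left (nhdsWithin_mono _ Ioi_subset_Ici_self)
    simpa [hc0] using h1.sub_const c₀
  have := (((hP.div_const M).pow 2).add (hA.pow 2)).add ((hcc.const_mul (M ^ 2)).pow 2)
  simp only [mul_zero, zero_div, ne_eq, OfNat.ofNat_ne_zero, not_false_eq_true, zero_pow,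
    add_zero] at this
  exact this

lemma abs_source_le {F x₁ x₂ x₃ t a b c : ℝ} (h₁ : |x₁| ≤ F) (h₂ : |x₂| ≤ F) (h₃ : |x₃| ≤ F) :
    |x₁ * t * b + x₂ * t ^ 2 * a + x₃ * c| ≤ F * (|t * b| + t ^ 2 * |a| + |c|) := by
  calc |x₁ * t * b + x₂ * t ^ 2 * a + x₃ * c|
      ≤ |x₁ * t * b| + |x₂ * t ^ 2 * a| + |x₃ * c| := abs_add_three _ _ _
    _ = |x₁| * |t * b| + |x₂| * (t ^ 2 * |a|) + |x₃| * |c| := by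
        rw [mul_assoc x₁, mul_assoc x₂, abs_mul x₁, abs_mul x₂, abs_mul x₃,
          abs_mul (t ^ 2), abs_of_nonneg (sq_nonneg t)]
    _ ≤ F * |t * b| + F * (t ^ 2 * |a|) + F * |c| := by gcongr
    _ = _ := by ring

lemma hasDerivAt_log_sq_primitive {M t : ℝ} (hM : 0 < M) (ht : 0 < t) (k : ℝ) :
    HasDerivAt (fun t => k * (M * t + M * t * (Real.log (M * t) ^ 2 - 2 * Real.log (M * t) + 2)))
      (k * (M * (1 + Real.log (M * t) ^ 2))) t := by
  have h0 : HasDerivAt (fun t : ℝ => M * t) M t := by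
    simpa using (hasDerivAt_id t).const_mul M
  have h1 := h0.log (mul_pos hM ht).ne'
  have h2 := (h0.add (h0.mul (((h1.pow 2).sub (h1.const_mul 2)).add_const 2))).const_mul k
  refine h2.congr_deriv ?_
  simp only [Pi.sub_apply, Pi.pow_apply, Nat.cast_ofNat]
  field_simp
  ring

lemma innerEnergy_le {q' F lam M : ℝ} {f₁ f₂ f₃ a c : ℝ → ℝ} {c₀ O h : ℝ} (hq : 1 ≤ q')
    (hF : 0 ≤ F) (h₁ : ∀ τ ≥ (0 : ℝ), |f₁ τ| ≤ F) (h₂ : ∀ τ ≥ (0 : ℝ), |f₂ τ| ≤ F)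
    (h₃ : ∀ τ ≥ (0 : ℝ), |f₃ τ| ≤ F) (hM : 1 ≤ M) (hM2 : M ^ 2 = 1 + lam ^ 2)
    (hs : SolvesModelSystem q' f₁ f₂ f₃ lam a c (Ioi 0)) (hd : HasAsymptoticData a c c₀ O h) :
    innerEnergy M a c c₀ O h M⁻¹ ≤ Real.exp (16 * q' + 12 * F + 10) *
      (3 * ((16 * q' + 12 * F + 10) *
        (O ^ 2 + (h - O * Real.log M) ^ 2 + (c₀ / M ^ 2) ^ 2))) := by
  obtain ⟨K, hK⟩ : ∃ K, K = 16 * q' + 12 * F + 10 := ⟨_, rfl⟩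
  obtain ⟨D, hD⟩ : ∃ D, D = O ^ 2 + (h - O * Real.log M) ^ 2 + (c₀ / M ^ 2) ^ 2 := ⟨_, rfl⟩
  rw [← hK, ← hD]
  have hK0 : 0 ≤ K := by rw [hK]; positivity
  have hD0 : 0 ≤ D := by rw [hD]; positivity
  have hM0 : 0 < M := by linarith
  have key : ∀ x, 0 < x → x ≤ M⁻¹ →
      Real.exp (-K) * innerEnergy M a c c₀ O h M⁻¹ - 3 * (K * D) ≤
        innerEnergy M a c c₀ O h x := by
    intro x hx hxM
    have hpos : ∀ t ∈ Icc x M⁻¹, 0 < t := fun t ht => hx.trans_le ht.1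
    have hG := gronwall_exp_le (u := innerEnergy M a c c₀ O h) (g := fun t => K * M * t)
      (r := fun t => K * D * (M * t + M * t * (Real.log (M * t) ^ 2 - 2 * Real.log (M * t) + 2)))
      (u' := fun t => 2 * ((deriv a t - O / t) / M) * ((deriv (deriv a) t + O / t ^ 2) / M)
        + 2 * (a t - O * Real.log t - h) * (deriv a t - O / t)
        + 2 * (M ^ 2 * (c t - c₀)) * (M ^ 2 * deriv c t))
      (g' := fun _ => K * M) (r' := fun t => K * D * (M * (1 + Real.log (M * t) ^ 2))) hxM
      ?_ ?_ ?_ ?_ ?_ ?_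
    · have hMi : M * M⁻¹ = 1 := mul_inv_cancel₀ hM0.ne'
      have e1 : K * M * M⁻¹ = K := by rw [mul_assoc, hMi, mul_one]
      simp only [hMi, e1, Real.log_one] at hG
      have e2 : Real.exp (-(K * M * x)) * innerEnergy M a c c₀ O h x
          ≤ innerEnergy M a c c₀ O h x := by
        apply mul_le_of_le_one_left (innerEnergy_nonneg _ _ _ _ _ _ _)
        apply Real.exp_le_one_iff.2
        have : 0 ≤ K * M * x := by positivity
        linarith
      have e3 : 0 ≤ K * D *
          (M * x + M * x * (Real.log (M * x) ^ 2 - 2 * Real.log (M * x) + 2)) := by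
        have : 0 ≤ Real.log (M * x) ^ 2 - 2 * Real.log (M * x) + 2 := by
          nlinarith [sq_nonneg (Real.log (M * x) - 1)]
        positivity
      linarith
    · intro t ht
      have ht0 := hpos t ht
      obtain ⟨da, dda, dc, -, -⟩ := hs t ht0
      have i1 : HasDerivAt (fun t => (deriv a t - O / t) / M)
          ((deriv (deriv a) t + O / t ^ 2) / M) t := by
        have := (dda.hasDerivAt.sub ((hasDerivAt_inv ht0.ne').const_mul O)).div_const M
        refine this.congr_deriv ?_
        field_simp
        ring
      have i2 : HasDerivAt (fun t => a t - O * Real.log t - h) (deriv a t - O / t) t :=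
        (da.hasDerivAt.sub ((Real.hasDerivAt_log ht0.ne').const_mul O)).sub_const h
      have i3 : HasDerivAt (fun t => M ^ 2 * (c t - c₀)) (M ^ 2 * deriv c t) t :=
        (dc.hasDerivAt.sub_const c₀).const_mul (M ^ 2)
      refine (((i1.pow 2).add (i2.pow 2)).add (i3.pow 2)).congr_deriv ?_
      simp
    · intro t _
      simpa using (hasDerivAt_id t).const_mul (K * M)
    · intro t ht
      exact hasDerivAt_log_sq_primitive hM0 (hpos t ht) (K * D)
    · intro t ht
      have := hpos t ht
      positivity
    · intro t ht
      have := hpos t ht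
      positivity
    · intro t ht
      have ht0 := hpos t ht
      have htM : M * t ≤ 1 := by
        have := mul_le_mul_of_nonneg_left ht.2 hM0.le
        rwa [mul_inv_cancel₀ hM0.ne'] at this
      have ht1 : t ≤ 1 := by nlinarith
      obtain ⟨-, -, -, hE, hC⟩ := hs t ht0
      obtain ⟨p, hp⟩ : ∃ p, p = (deriv a t - O / t) / M := ⟨_, rfl⟩
      obtain ⟨A, hA⟩ : ∃ A, A = a t - O * Real.log t - h := ⟨_, rfl⟩
      obtain ⟨e, he⟩ : ∃ e, e = M ^ 2 * (c t - c₀) := ⟨_, rfl⟩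
      obtain ⟨G, hG⟩ : ∃ G, G = f₁ t * t * deriv a t + f₂ t * t ^ 2 * a t + f₃ t * c t :=
        ⟨_, rfl⟩
      have hM21 : 1 ≤ M ^ 2 := one_le_pow₀ hM
      have hwl := sq_le_modePotential hq hM2 ht0.le ht1
      have hwu := modePotential_le t hq hM2
      have hGb : |G / M ^ 2| ≤ F * (|p| + |O| + |a t| + |c₀ / M ^ 2| + |e|) := by
        rw [abs_div, abs_of_pos (by positivity : 0 < M ^ 2), div_le_iff₀ (by positivity), hG]
        refine (abs_source_le (h₁ t ht0.le) (h₂ t ht0.le) (h₃ t ht0.le)).trans ?_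
        rw [mul_assoc]
        apply mul_le_mul_of_nonneg_left _ hF
        have g1 : |t * deriv a t| ≤ |p| + |O| := by
          have : t * deriv a t = (M * t) * p + O := by rw [hp]; field_simp; ring
          rw [this]
          refine (abs_add_le _ _).trans ?_
          rw [abs_mul, abs_of_pos (by positivity : 0 < M * t)]
          gcongr
          exact mul_le_of_le_one_left (abs_nonneg p) htM
        have g2 : t ^ 2 * |a t| ≤ |a t| :=
          mul_le_of_le_one_left (abs_nonneg _) (pow_le_one₀ ht0.le ht1)
        have g3 : |c t| ≤ |c₀ / M ^ 2| * M ^ 2 + |e| := by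
          have : c t = c₀ + (c t - c₀) := by ring
          rw [this]
          refine (abs_add_le _ _).trans ?_
          rw [abs_div, he, abs_mul, abs_of_pos (by positivity : 0 < M ^ 2),
            div_mul_cancel₀ _ (by positivity)]
          gcongr
          exact le_mul_of_one_le_left (abs_nonneg _) hM21
        have n1 : 0 ≤ |p| + |O| + |a t| + |e| := by positivity
        nlinarith [mul_le_mul_of_nonneg_left hM21 n1]
      have hmain := inner_energy_bound (q' := q') (F := F) (s := M * t) (p := p) (A := A) (e := e)
        (O := O) (L := Real.log (M * t)) (H := h - O * Real.log M) (γ := c₀ / M ^ 2) (a := a t)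
        (v := modePotential q' lam t / M ^ 2) (G := G / M ^ 2) (by linarith) hF (by positivity)
        htM (by rw [hA, Real.log_mul hM0.ne' ht0.ne']; ring)
        (div_nonneg ((sq_nonneg M).trans hwl) (sq_nonneg M))
        (by rw [div_le_iff₀ (by positivity)]; exact hwu) hGb
      rw [← hK, ← hD] at hmain
      have hdd : deriv (deriv a) t + O / t ^ 2 =
          M ^ 2 * (-p / (M * t) - modePotential q' lam t / M ^ 2 * a t + G / M ^ 2) := by
        have hpt : p / (M * t) * M ^ 2 = t⁻¹ * deriv a t - O / t ^ 2 := by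
          rw [hp]; field_simp
        have hw : modePotential q' lam t / M ^ 2 * M ^ 2 = modePotential q' lam t :=
          div_mul_cancel₀ _ (by positivity)
        have hg : G / M ^ 2 * M ^ 2 = G := div_mul_cancel₀ _ (by positivity)
        have : M ^ 2 * (-p / (M * t) - modePotential q' lam t / M ^ 2 * a t + G / M ^ 2)
          = -(p / (M * t) * M ^ 2) - (modePotential q' lam t / M ^ 2 * M ^ 2) * a t
            + G / M ^ 2 * M ^ 2 := by ring
        rw [this, hpt, hw, hg, hG]
        unfold modePotential
        linarith
      have hpM : deriv a t - O / t = M * p := by rw [hp]; field_simp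
      have hu : innerEnergy M a c c₀ O h t = p ^ 2 + A ^ 2 + e ^ 2 := by
        rw [innerEnergy, hp, hA, he]
      have hlhs : 2 * ((deriv a t - O / t) / M) * ((deriv (deriv a) t + O / t ^ 2) / M)
          + 2 * (a t - O * Real.log t - h) * (deriv a t - O / t)
          + 2 * (M ^ 2 * (c t - c₀)) * (M ^ 2 * deriv c t) =
          M * (2 * p * (-p / (M * t) - modePotential q' lam t / M ^ 2 * a t + G / M ^ 2)
            + 2 * A * p + 4 * e * (M * t) * a t) := by
        obtain ⟨R, hR⟩ : ∃ R,
            R = -p / (M * t) - modePotential q' lam t / M ^ 2 * a t + G / M ^ 2 := ⟨_, rfl⟩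
        have hRM : M ^ 2 * R / M = M * R := by field_simp
        rw [← hp, ← hA, ← he, hdd, hC, hpM, ← hR, hRM]
        ring
      rw [hlhs, hu]
      calc _ ≤ M * (K * (p ^ 2 + A ^ 2 + e ^ 2 + D * (1 + Real.log (M * t) ^ 2))) :=
            mul_le_mul_of_nonneg_left hmain hM0.le
        _ = _ := by ring
  have hlim : Real.exp (-K) * innerEnergy M a c c₀ O h M⁻¹ - 3 * (K * D) ≤ 0 := by
    apply ge_of_tendsto (tendsto_innerEnergy M hd)
    filter_upwards [Ioc_mem_nhdsGT (inv_pos.2 hM0)] with x hx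
    exact key x hx.1 hx.2
  rw [Real.exp_neg, sub_nonpos, inv_mul_le_iff₀ (Real.exp_pos K)] at hlim
  exact hlim

/-- The corrected weighted energy on the oscillatory region. -/
noncomputable def outerEnergy (q' lam μ : ℝ) (a c : ℝ → ℝ) (t : ℝ) : ℝ :=
  t * (deriv a t ^ 2 + modePotential q' lam t * a t ^ 2) + a t * deriv a t + μ * c t ^ 2

lemma outerEnergy_one_le {q' F lam M μ : ℝ} {f₁ f₂ f₃ a c : ℝ → ℝ} (hq : 1 ≤ q')
    (hF : 0 ≤ F) (h₁ : ∀ τ ≥ (0 : ℝ), |f₁ τ| ≤ F) (h₂ : ∀ τ ≥ (0 : ℝ), |f₂ τ| ≤ F)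
    (h₃ : ∀ τ ≥ (0 : ℝ), |f₃ τ| ≤ F) (hM : 1 ≤ M) (hM2 : M ^ 2 = 1 + lam ^ 2)
    (hμ : 1 ≤ μ) (hμM : μ ≤ M ^ 2)
    (hs : SolvesModelSystem q' f₁ f₂ f₃ lam a c (Ioi 0))
    (hnn : 0 ≤ outerEnergy q' lam μ a c M⁻¹) :
    outerEnergy q' lam μ a c 1 ≤
      Real.exp (20 * (F + 1) + 1) * outerEnergy q' lam μ a c M⁻¹ := by
  have hM0 : 0 < M := by linarith
  have hMi : M⁻¹ ≤ 1 := inv_le_one_of_one_le₀ hM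
  have hMi0 : 0 < M⁻¹ := inv_pos.2 hM0
  have hpos : ∀ t ∈ Icc M⁻¹ 1, 0 < t := fun t ht => hMi0.trans_le ht.1
  have hMt : ∀ t ∈ Icc M⁻¹ 1, 1 ≤ M * t := fun t ht => by
    have := mul_le_mul_of_nonneg_left ht.1 hM0.le
    rwa [mul_inv_cancel₀ hM0.ne'] at this
  have hG := gronwall_exp_le (u := outerEnergy q' lam μ a c)
    (g := fun t => 20 * (F + 1) * t - M⁻¹ * t⁻¹ + 1) (r := fun _ => 0)
    (u' := fun t => (deriv a t ^ 2 + modePotential q' lam t * a t ^ 2)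
      + t * (2 * deriv a t * deriv (deriv a) t
        + (-(16 * lam ^ 2 * t * ((t ^ 2 + 1) ^ 3)⁻¹) * a t ^ 2
          + modePotential q' lam t * (2 * a t * deriv a t)))
      + (deriv a t * deriv a t + a t * deriv (deriv a) t) + μ * (2 * c t * deriv c t))
    (g' := fun t => 20 * (F + 1) + 1 / (M * t ^ 2)) (r' := fun _ => 0) hMi ?_ ?_ ?_ ?_ ?_ ?_
  · have e1 : Real.exp (-(20 * (F + 1) * M⁻¹ - M⁻¹ * M⁻¹⁻¹ + 1))
        * outerEnergy q' lam μ a c M⁻¹ ≤ outerEnergy q' lam μ a c M⁻¹ := by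
      apply mul_le_of_le_one_left hnn
      apply Real.exp_le_one_iff.2
      rw [inv_inv, inv_mul_cancel₀ hM0.ne']
      have : 0 ≤ 20 * (F + 1) * M⁻¹ := by positivity
      linarith
    have e2 : Real.exp (-(20 * (F + 1) * 1 - M⁻¹ * 1⁻¹ + 1)) * outerEnergy q' lam μ a c 1
        ≤ outerEnergy q' lam μ a c M⁻¹ := by
      simpa using hG.trans (sub_le_sub_right e1 0)
    rw [Real.exp_neg, inv_mul_le_iff₀ (Real.exp_pos _)] at e2
    refine e2.trans (mul_le_mul_of_nonneg_right (Real.exp_le_exp.2 ?_) hnn)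
    rw [inv_one]
    linarith
  · intro t ht
    obtain ⟨da, dda, dc, -, -⟩ := hs t (hpos t ht)
    have i1 := (hasDerivAt_id t).mul ((dda.hasDerivAt.pow 2).add
      ((hasDerivAt_modePotential q' lam t).mul (da.hasDerivAt.pow 2)))
    have i2 := da.hasDerivAt.mul dda.hasDerivAt
    have i3 := (dc.hasDerivAt.pow 2).const_mul μ
    refine ((i1.add i2).add i3).congr_deriv ?_
    simp
  · intro t ht
    have ht0 := (hpos t ht).ne'
    have := (((hasDerivAt_id t).const_mul (20 * (F + 1))).sub
      ((hasDerivAt_inv ht0).const_mul M⁻¹)).add_const 1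
    refine this.congr_deriv ?_
    field_simp
    ring
  · intro t _
    exact hasDerivAt_const t 0
  · intro t ht
    have ht0 := hpos t ht
    have : M⁻¹ * t⁻¹ ≤ 1 := by
      rw [← mul_inv]
      exact inv_le_one_of_one_le₀ (hMt t ht)
    have : 0 ≤ 20 * (F + 1) * t := by positivity
    linarith
  · intro t _
    exact le_rfl
  · intro t ht
    have ht0 := hpos t ht
    obtain ⟨-, -, -, hE, hC⟩ := hs t ht0
    have hGb := abs_source_le (t := t) (a := a t) (b := deriv a t) (c := c t)
      (h₁ t ht0.le) (h₂ t ht0.le) (h₃ t ht0.le)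
    rw [abs_mul, abs_of_pos ht0] at hGb
    have hw' : -(16 * lam ^ 2 * t * ((t ^ 2 + 1) ^ 3)⁻¹) ≤ 0 := by
      have : 0 ≤ 16 * lam ^ 2 * t * ((t ^ 2 + 1) ^ 3)⁻¹ := by positivity
      linarith
    have hmain := outer_energy_bound hF hM ht0 (hMt t ht) ht.2
      (sq_le_modePotential hq hM2 ht0.le ht.2) hw' hμ hμM hGb
    rw [add_zero]
    refine le_trans (le_of_eq ?_) hmain
    have hdd : deriv (deriv a) t = -(deriv a t / t) - modePotential q' lam t * a t
        + (f₁ t * t * deriv a t + f₂ t * t ^ 2 * a t + f₃ t * c t) := by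
      rw [← hE, modePotential]
      ring
    rw [hdd, hC]
    field_simp
    ring

lemma energy_le_two_mul_outerEnergy {q' lam M μ t : ℝ} (a c : ℝ → ℝ) (hq : 1 ≤ q') (hM : 1 ≤ M)
    (hM2 : M ^ 2 = 1 + lam ^ 2) (hμ : 0 ≤ μ) (hMt : 1 ≤ M * t) (ht : 0 < t) (ht1 : t ≤ 1) :
    t * (deriv a t ^ 2 + modePotential q' lam t * a t ^ 2) + μ * c t ^ 2
      ≤ 2 * outerEnergy q' lam μ a c t ∧
    outerEnergy q' lam μ a c t ≤
      2 * (t * (deriv a t ^ 2 + modePotential q' lam t * a t ^ 2) + μ * c t ^ 2) := by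
  have hw := sq_le_modePotential hq hM2 ht.le ht1
  have hw0 : 0 ≤ modePotential q' lam t := (sq_nonneg M).trans hw
  have h1 := abs_mul_le_energy (x := a t) (y := deriv a t) hM ht hw
  have hE : 0 ≤ t * (deriv a t ^ 2 + modePotential q' lam t * a t ^ 2) := by positivity
  have h2 : t * (deriv a t ^ 2 + modePotential q' lam t * a t ^ 2) / (2 * (M * t))
      ≤ t * (deriv a t ^ 2 + modePotential q' lam t * a t ^ 2) / 2 :=
    div_le_div_of_nonneg_left hE (by norm_num) (by linarith)
  have h3 := abs_le.1 (h1.trans h2)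
  have h4 : 0 ≤ μ * c t ^ 2 := by positivity
  unfold outerEnergy
  constructor <;> linarith [h3.1, h3.2]

/-- The weighted energy at `τ = 1` in terms of the asymptotic data, for any weight
`μ ∈ [1, 1 + lam²]` on `c`. -/
lemma exists_weighted_forward_estimate (q' F : ℝ) (hq : 1 ≤ q') (hF : 0 ≤ F) :
    ∃ C > 0, ∀ f₁ f₂ f₃ : ℝ → ℝ,
      (∀ τ ≥ (0 : ℝ), |f₁ τ| ≤ F) → (∀ τ ≥ (0 : ℝ), |f₂ τ| ≤ F) →
      (∀ τ ≥ (0 : ℝ), |f₃ τ| ≤ F) →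
      ∀ lam M μ : ℝ, 1 ≤ M → M ^ 2 = 1 + lam ^ 2 → 1 ≤ μ → μ ≤ M ^ 2 →
      ∀ a c : ℝ → ℝ, ∀ c₀ O h : ℝ,
      SolvesModelSystem q' f₁ f₂ f₃ lam a c (Ioi 0) → HasAsymptoticData a c c₀ O h →
      deriv a 1 ^ 2 + M ^ 2 * a 1 ^ 2 + μ * c 1 ^ 2 ≤
        C * (M * ((h - O * Real.log M) ^ 2 + O ^ 2) + μ * c₀ ^ 2) := by
  obtain ⟨K, hK⟩ : ∃ K, K = Real.exp (16 * q' + 12 * F + 10) *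
      (3 * (16 * q' + 12 * F + 10)) := ⟨_, rfl⟩
  have hK0 : 0 ≤ K := by rw [hK]; positivity
  refine ⟨2 * (Real.exp (20 * (F + 1) + 1) * (2 * ((12 * q' + 12) * (K + 1)))), by positivity, ?_⟩
  intro f₁ f₂ f₃ h₁ h₂ h₃ lam M μ hM hM2 hμ hμM a c c₀ O h hs hd
  have hM0 : 0 < M := by linarith
  have hM21 : 1 ≤ M ^ 2 := one_le_pow₀ hM
  have hMi : M⁻¹ ≤ 1 := inv_le_one_of_one_le₀ hM
  have hMi0 : 0 < M⁻¹ := inv_pos.2 hM0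
  obtain ⟨H, hH⟩ : ∃ H, H = h - O * Real.log M := ⟨_, rfl⟩
  obtain ⟨S, hS⟩ : ∃ S, S = M * (H ^ 2 + O ^ 2) + μ * c₀ ^ 2 := ⟨_, rfl⟩
  rw [← hH, ← hS]
  have hc0S : μ * c₀ ^ 2 ≤ S := by
    have : 0 ≤ M * (H ^ 2 + O ^ 2) := by positivity
    linarith
  have hc0 : 0 ≤ μ * c₀ ^ 2 := by positivity
  have hS0 : 0 ≤ S := hc0.trans hc0S
  have hHS : M * H ^ 2 ≤ S := by nlinarith [mul_nonneg hM0.le (sq_nonneg O)]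
  have hOS : M * O ^ 2 ≤ S := by nlinarith [mul_nonneg hM0.le (sq_nonneg H)]
  obtain ⟨lo1, -⟩ := energy_le_two_mul_outerEnergy (t := 1) a c hq hM hM2 (by linarith : 0 ≤ μ)
    (by linarith) one_pos le_rfl
  obtain ⟨lo, hi⟩ := energy_le_two_mul_outerEnergy (t := M⁻¹) a c hq hM hM2
    (by linarith : 0 ≤ μ) (mul_inv_cancel₀ hM0.ne').ge hMi0 hMi
  have hw0 : 0 ≤ modePotential q' lam M⁻¹ :=
    (sq_nonneg M).trans (sq_le_modePotential hq hM2 hMi0.le hMi)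
  have hwu := modePotential_le M⁻¹ hq hM2
  have hnn : 0 ≤ outerEnergy q' lam μ a c M⁻¹ := by
    have : 0 ≤ M⁻¹ * (deriv a M⁻¹ ^ 2 + modePotential q' lam M⁻¹ * a M⁻¹ ^ 2)
      + μ * c M⁻¹ ^ 2 := by positivity
    linarith
  have hout := outerEnergy_one_le hq hF h₁ h₂ h₃ hM hM2 hμ hμM hs hnn
  have hin := innerEnergy_le hq hF h₁ h₂ h₃ hM hM2 hs hd
  obtain ⟨W, hW⟩ : ∃ W, W = innerEnergy M a c c₀ O h M⁻¹ := ⟨_, rfl⟩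
  have hWS : M * W ≤ K * S := by
    rw [← hW, ← hH] at hin
    have hγ : M * (c₀ / M ^ 2) ^ 2 ≤ μ * c₀ ^ 2 := by
      have h1 : M * (c₀ / M ^ 2) ^ 2 = c₀ ^ 2 / M ^ 3 := by field_simp
      rw [h1]
      calc c₀ ^ 2 / M ^ 3 ≤ c₀ ^ 2 := div_le_self (sq_nonneg _) (one_le_pow₀ hM)
        _ ≤ μ * c₀ ^ 2 := le_mul_of_one_le_left (sq_nonneg _) hμ
    calc M * W ≤ M * (Real.exp (16 * q' + 12 * F + 10) *
          (3 * ((16 * q' + 12 * F + 10) * (O ^ 2 + H ^ 2 + (c₀ / M ^ 2) ^ 2)))) := by gcongr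
      _ = K * (M * (H ^ 2 + O ^ 2) + M * (c₀ / M ^ 2) ^ 2) := by rw [hK]; ring
      _ ≤ K * S := by rw [hS]; gcongr
  obtain ⟨p, hp⟩ : ∃ p, p = (deriv a M⁻¹ - O / M⁻¹) / M := ⟨_, rfl⟩
  obtain ⟨A, hA⟩ : ∃ A, A = a M⁻¹ - O * Real.log M⁻¹ - h := ⟨_, rfl⟩
  obtain ⟨e, he⟩ : ∃ e, e = M ^ 2 * (c M⁻¹ - c₀) := ⟨_, rfl⟩
  have hWe : W = p ^ 2 + A ^ 2 + e ^ 2 := by rw [hW, innerEnergy, hp, hA, he]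
  have da : deriv a M⁻¹ = M * (p + O) := by
    rw [hp]; field_simp; ring
  have aa : a M⁻¹ = A + H := by
    rw [hA, hH, Real.log_inv]; ring
  have b1 : M⁻¹ * deriv a M⁻¹ ^ 2 ≤ 2 * (K * S + S) := by
    have : M⁻¹ * deriv a M⁻¹ ^ 2 = M * (p + O) ^ 2 := by rw [da]; field_simp
    rw [this]
    have h1 : M * (p + O) ^ 2 ≤ M * (2 * (W + O ^ 2)) := by
      apply mul_le_mul_of_nonneg_left _ hM0.le
      have := add_sq_le (a := p) (b := O)
      linarith [sq_nonneg A, sq_nonneg e]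
    linarith
  have b2 : M⁻¹ * (modePotential q' lam M⁻¹ * a M⁻¹ ^ 2) ≤ 8 * q' * (K * S + S) := by
    have h1 : M * (A + H) ^ 2 ≤ M * (2 * (W + H ^ 2)) := by
      apply mul_le_mul_of_nonneg_left _ hM0.le
      have := add_sq_le (a := A) (b := H)
      linarith [sq_nonneg p, sq_nonneg e]
    have h2 : M * (A + H) ^ 2 ≤ 2 * (K * S + S) := by linarith
    calc M⁻¹ * (modePotential q' lam M⁻¹ * a M⁻¹ ^ 2)
        ≤ M⁻¹ * (4 * q' * M ^ 2 * a M⁻¹ ^ 2) := by gcongr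
      _ = 4 * q' * (M * (A + H) ^ 2) := by rw [aa]; field_simp
      _ ≤ 4 * q' * (2 * (K * S + S)) := by gcongr
      _ = _ := by ring
  have b3 : μ * c M⁻¹ ^ 2 ≤ 2 * (K * S + S) := by
    have h0 : c M⁻¹ = c₀ + (c M⁻¹ - c₀) := by ring
    have h1 : c M⁻¹ ^ 2 ≤ 2 * c₀ ^ 2 + 2 * (c M⁻¹ - c₀) ^ 2 := by
      have := add_sq_le (a := c₀) (b := c M⁻¹ - c₀)
      rw [← h0] at this
      linarith
    have h2 : μ * (c M⁻¹ - c₀) ^ 2 ≤ W := by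
      calc μ * (c M⁻¹ - c₀) ^ 2 ≤ M ^ 2 * (c M⁻¹ - c₀) ^ 2 := by gcongr
        _ ≤ M ^ 2 * (M ^ 2 * (c M⁻¹ - c₀) ^ 2) := by
          apply mul_le_mul_of_nonneg_left _ (sq_nonneg M)
          exact le_mul_of_one_le_left (sq_nonneg _) hM21
        _ = e ^ 2 := by rw [he]; ring
        _ ≤ W := by rw [hWe]; linarith [sq_nonneg p, sq_nonneg A]
    have h3 : W ≤ M * W := le_mul_of_one_le_left (by rw [hWe]; positivity) hM
    have h4 := mul_le_mul_of_nonneg_left h1 (by linarith : 0 ≤ μ)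
    have h5 : μ * (2 * c₀ ^ 2 + 2 * (c M⁻¹ - c₀) ^ 2)
        = 2 * (μ * c₀ ^ 2) + 2 * (μ * (c M⁻¹ - c₀) ^ 2) := by ring
    linarith
  have hT : outerEnergy q' lam μ a c M⁻¹ ≤ 2 * ((12 * q' + 12) * (K + 1) * S) := by
    have hKS : 0 ≤ (4 * q' + 8) * ((K + 1) * S) := by positivity
    have h1 : (12 * q' + 12) * (K + 1) * S
        = (8 * q' + 4) * (K * S + S) + (4 * q' + 8) * ((K + 1) * S) := by ring
    refine hi.trans ?_
    rw [h1, mul_add M⁻¹]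
    linarith
  have hw1 := sq_le_modePotential (t := 1) hq hM2 zero_le_one le_rfl
  calc deriv a 1 ^ 2 + M ^ 2 * a 1 ^ 2 + μ * c 1 ^ 2
      ≤ 1 * (deriv a 1 ^ 2 + modePotential q' lam 1 * a 1 ^ 2) + μ * c 1 ^ 2 := by
        rw [one_mul]; gcongr
    _ ≤ 2 * outerEnergy q' lam μ a c 1 := lo1
    _ ≤ 2 * (Real.exp (20 * (F + 1) + 1) * (2 * ((12 * q' + 12) * (K + 1) * S))) := by
        gcongr
        exact hout.trans (mul_le_mul_of_nonneg_left hT (Real.exp_pos _).le)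
    _ = _ := by ring

/-- Improved-regularity forward estimate (single-mode version of Theorem 3.6
of the paper). -/
theorem improved_regularity_forward_estimate (q' F : ℝ) (hq : 1 ≤ q') (hF : 0 ≤ F) :
    ∃ C > 0, ∀ f₁ f₂ f₃ : ℝ → ℝ,
      ContinuousOn f₁ (Ici 0) → ContinuousOn f₂ (Ici 0) → ContinuousOn f₃ (Ici 0) →
      (∀ τ ≥ (0:ℝ), |f₁ τ| ≤ F) → (∀ τ ≥ (0:ℝ), |f₂ τ| ≤ F) → (∀ τ ≥ (0:ℝ), |f₃ τ| ≤ F) →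
      ∀ lam : ℝ, 0 ≤ lam →
      ∀ a c : ℝ → ℝ, ∀ c₀ O h : ℝ,
      SolvesModelSystem q' f₁ f₂ f₃ lam a c (Ioi 0) →
      HasAsymptoticData a c c₀ O h →
      (Real.sqrt (1 + lam ^ 2) * a 1 ^ 2 + (Real.sqrt (1 + lam ^ 2))⁻¹ * deriv a 1 ^ 2
          ≤ C * ((h - O * Real.log (Real.sqrt (1 + lam ^ 2))) ^ 2 + O ^ 2
              + (Real.sqrt (1 + lam ^ 2))⁻¹ * c₀ ^ 2)) ∧
      (Real.sqrt (1 + lam ^ 2) * c 1 ^ 2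
          ≤ C * ((h - O * Real.log (Real.sqrt (1 + lam ^ 2))) ^ 2 + O ^ 2
              + Real.sqrt (1 + lam ^ 2) * c₀ ^ 2)) := by
  obtain ⟨C, hC, H⟩ := exists_weighted_forward_estimate q' F hq hF
  refine ⟨C, hC, ?_⟩
  intro f₁ f₂ f₃ _ _ _ h₁ h₂ h₃ lam _ a c c₀ O h hs hd
  obtain ⟨M, hMdef⟩ : ∃ M, M = Real.sqrt (1 + lam ^ 2) := ⟨_, rfl⟩
  rw [← hMdef]
  have hM2 : M ^ 2 = 1 + lam ^ 2 := by rw [hMdef, Real.sq_sqrt (by positivity)]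
  have hM : 1 ≤ M := by
    rw [hMdef, Real.one_le_sqrt]
    nlinarith [sq_nonneg lam]
  have hM0 : 0 < M := by linarith
  have hM21 : 1 ≤ M ^ 2 := one_le_pow₀ hM
  have H₁ := H f₁ f₂ f₃ h₁ h₂ h₃ lam M 1 hM hM2 le_rfl hM21 a c c₀ O h hs hd
  have H₂ := H f₁ f₂ f₃ h₁ h₂ h₃ lam M (M ^ 2) hM hM2 hM21 le_rfl a c c₀ O h hs hd
  constructor
  · have e1 : M * a 1 ^ 2 + M⁻¹ * deriv a 1 ^ 2
        = M⁻¹ * (deriv a 1 ^ 2 + M ^ 2 * a 1 ^ 2) := by field_simp; ring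
    have e2 : C * ((h - O * Real.log M) ^ 2 + O ^ 2 + M⁻¹ * c₀ ^ 2)
        = M⁻¹ * (C * (M * ((h - O * Real.log M) ^ 2 + O ^ 2) + 1 * c₀ ^ 2)) := by field_simp
    rw [e1, e2]
    apply mul_le_mul_of_nonneg_left _ (inv_pos.2 hM0).le
    nlinarith [sq_nonneg (c 1)]
  · have e1 : M * c 1 ^ 2 = M⁻¹ * (M ^ 2 * c 1 ^ 2) := by field_simp
    have e2 : C * ((h - O * Real.log M) ^ 2 + O ^ 2 + M * c₀ ^ 2)
        = M⁻¹ * (C * (M * ((h - O * Real.log M) ^ 2 + O ^ 2) + M ^ 2 * c₀ ^ 2)) := by field_simp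
    rw [e1, e2]
    apply mul_le_mul_of_nonneg_left _ (inv_pos.2 hM0).le
    nlinarith [sq_nonneg (deriv a 1), mul_nonneg (sq_nonneg M) (sq_nonneg (a 1))]
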